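/- Let H be a Tonelli Hamiltonian on the flat torus 𝕋ⁿ, B a magnetic field on 𝕋ⁿ, and let k < e₀(H) := sup_{q∈ℝⁿ} inf_{p∈ℝⁿ} H(q,p). Then there exist R > 0, a smooth function F : ℝ × ℝⁿ × ℝⁿ → ℝ with F(t, q+m, p) = F(t,q,p) for all m ∈ ℤⁿ and F(t,q,p) = 0 whenever ‖p‖ ≥ R, and a smooth map Φ : ℝ × (ℝⁿ × ℝⁿ) → ℝⁿ × ℝⁿ, Φ(t,(q,p)) = (Q(t,q,p), P(t,q,p)), such that: Φ(0,·) is the identity; ∂_t Q = ∇_p F(t, Q, P) and ∂_t P = −∇_q F(t, Q, P) − B(Q) ∇_p F(t, Q, P); Φ(t, (q+m, p)) = Φ(t,(q,p)) + (m,0) for all m ∈ ℤⁿ; and for every (q,p) with H(q,p) ≤ k one has H(Φ(1,(q,p))) > k. -/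

import Mathlib

open MeasureTheory
open scoped RealInnerProductSpace

section ODE
open Set Filter Topology Interval

/-- Picard iterates with parameters. -/
noncomputable def picIter {P E : Type*} [NormedAddCommGroup E] [NormedSpace ℝ E]
    (f : ℝ × P × E → E) (a : P → E) : ℕ → ℝ × P → E
  | 0 => fun z => a z.2
  | n + 1 => fun z => a z.2 + ∫ s in (0 : ℝ)..z.1, f (s, z.2, picIter f a n (s, z.2))

theorem continuous_picIter {P E : Type*} [TopologicalSpace P] [FirstCountableTopology P]
    [NormedAddCommGroup E] [NormedSpace ℝ E]
    {f : ℝ × P × E → E} {a : P → E} (hf : Continuous f) (ha : Continuous a) (n : ℕ) :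
    Continuous (picIter f a n) := by
  induction n with
  | zero => exact ha.comp continuous_snd
  | succ n ih =>
    refine (ha.comp continuous_snd).add ?_
    refine intervalIntegral.continuous_parametric_intervalIntegral_of_continuous
      (f := fun (z : ℝ × P) s => f (s, z.2, picIter f a n (s, z.2))) ?_ continuous_fst
    fun_prop

theorem picIter_bound {P E : Type*} [TopologicalSpace P] [FirstCountableTopology P]
    [NormedAddCommGroup E] [NormedSpace ℝ E]
    {f : ℝ × P × E → E} {a : P → E} (hf : Continuous f) (ha : Continuous a)
    {T K D : ℝ} {C : Set P} (hK : 0 ≤ K)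
    (hL : ∀ t, |t| ≤ T → ∀ p ∈ C, ∀ x y, ‖f (t, p, x) - f (t, p, y)‖ ≤ K * ‖x - y‖)
    (hD : ∀ t, |t| ≤ T → ∀ p ∈ C, ‖picIter f a 1 (t, p) - picIter f a 0 (t, p)‖ ≤ D)
    (n : ℕ) : ∀ t, |t| ≤ T → ∀ p ∈ C,
      ‖picIter f a (n + 1) (t, p) - picIter f a n (t, p)‖ ≤ D * (K * |t|) ^ n / n.factorial := by
  induction n with
  | zero => intro t ht p hp; simpa using hD t ht p hp
  | succ n ih =>
    intro t ht p hp
    have hc : ∀ m, Continuous fun s : ℝ => f (s, p, picIter f a m (s, p)) := by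
      intro m
      have := continuous_picIter hf ha m
      fun_prop
    have e : picIter f a (n + 1 + 1) (t, p) - picIter f a (n + 1) (t, p)
        = ∫ s in (0 : ℝ)..t, (f (s, p, picIter f a (n + 1) (s, p))
            - f (s, p, picIter f a n (s, p))) := by
      rw [intervalIntegral.integral_sub ((hc _).intervalIntegrable _ _)
        ((hc _).intervalIntegrable _ _)]
      simp only [picIter]
      abel
    rw [e]
    have hcc := ((hc (n + 1)).sub (hc n)).norm
    calc _ ≤ ∫ s in Ι 0 t, ‖f (s, p, picIter f a (n + 1) (s, p))
            - f (s, p, picIter f a n (s, p))‖ := 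
          intervalIntegral.norm_integral_le_integral_norm_uIoc
      _ ≤ ∫ s in Ι 0 t, (D * K ^ (n + 1) / n.factorial) * |s - 0| ^ n := by
          refine setIntegral_mono_on ?_ ?_ measurableSet_uIoc ?_
          · exact (hcc.continuousOn.integrableOn_compact isCompact_uIcc).mono_set
              uIoc_subset_uIcc
          · have h2 : Continuous fun s : ℝ => (D * K ^ (n + 1) / n.factorial) * |s - 0| ^ n := by
              fun_prop
            exact (h2.continuousOn.integrableOn_compact isCompact_uIcc).mono_set
              uIoc_subset_uIcc
          · intro s hs
            have hst : |s| ≤ T := by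
              have := uIoc_subset_uIcc hs
              have h3 := Set.abs_sub_left_of_mem_uIcc this
              simp at h3
              linarith
            refine (hL s hst p hp _ _).trans ?_
            have := ih s hst p hp
            calc _ ≤ K * (D * (K * |s|) ^ n / n.factorial) := by gcongr
              _ = _ := by rw [sub_zero, mul_pow]; ring
      _ = _ := by
          rw [integral_const_mul, integral_pow_abs_sub_uIoc, Nat.factorial_succ]
          push_cast
          rw [sub_zero, mul_pow]
          field_simp

/-- Global solutions with continuous dependence on parameters. -/
theorem exists_param_solution {P E : Type*} [TopologicalSpace P] [FirstCountableTopology P]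
    [WeaklyLocallyCompactSpace P] [NormedAddCommGroup E] [NormedSpace ℝ E] [CompleteSpace E]
    {f : ℝ × P × E → E} {a : P → E} (hf : Continuous f) (ha : Continuous a)
    (hL : ∀ T : ℝ, ∀ C : Set P, IsCompact C → ∃ K : ℝ, 0 ≤ K ∧
      ∀ t, |t| ≤ T → ∀ p ∈ C, ∀ x y, ‖f (t, p, x) - f (t, p, y)‖ ≤ K * ‖x - y‖) :
    ∃ Φ : ℝ × P → E, Continuous Φ ∧ (∀ p, Φ (0, p) = a p) ∧
      ∀ t p, HasDerivAt (fun s => Φ (s, p)) (f (t, p, Φ (t, p))) t := by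
  have key : ∀ T : ℝ, ∀ C : Set P, IsCompact C → ∃ u : ℕ → ℝ, Summable u ∧
      ∀ n, ∀ z ∈ Icc (-T) T ×ˢ C, ‖picIter f a (n + 1) z - picIter f a n z‖ ≤ u n := by
    intro T C hC
    obtain ⟨K, hK, hKL⟩ := hL T C hC
    have hc : Continuous fun z => picIter f a 1 z - picIter f a 0 z :=
      (continuous_picIter hf ha 1).sub (continuous_picIter hf ha 0)
    obtain ⟨D, hD⟩ := (isCompact_Icc.prod hC).exists_bound_of_continuousOn
      (s := Icc (-T) T ×ˢ C) hc.continuousOn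
    refine ⟨fun n => |D| * ((K * T) ^ n / n.factorial),
      (Real.summable_pow_div_factorial _).mul_left _, ?_⟩
    rintro n ⟨t, p⟩ ⟨ht, hp⟩
    have ht' : |t| ≤ T := abs_le.2 ht
    refine (picIter_bound hf ha hK hKL
      (D := |D|) (fun t ht p hp => (hD (t, p) ⟨abs_le.1 ht, hp⟩).trans (le_abs_self _))
      n t ht' p hp).trans ?_
    calc |D| * (K * |t|) ^ n / n.factorial = |D| * ((K * |t|) ^ n / n.factorial) := by ring
      _ ≤ |D| * ((K * T) ^ n / n.factorial) := by gcongr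
  let Φ : ℝ × P → E := fun z => a z.2 + ∑' n, (picIter f a (n + 1) z - picIter f a n z)
  have hsum : ∀ N z, a z.2 + ∑ n ∈ Finset.range N, (picIter f a (n + 1) z - picIter f a n z)
      = picIter f a N z := by
    intro N z
    rw [Finset.sum_range_sub (fun n => picIter f a n z)]
    simp [picIter]
  have hunif : ∀ T : ℝ, ∀ C : Set P, IsCompact C →
      TendstoUniformlyOn (fun N => picIter f a N) Φ atTop (Icc (-T) T ×ˢ C) := by
    intro T C hC
    obtain ⟨u, hu, hb⟩ := key T C hC
    have h1 := tendstoUniformlyOn_tsum_nat hu hb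
    rw [Metric.tendstoUniformlyOn_iff] at h1 ⊢
    intro ε hε
    filter_upwards [h1 ε hε] with N hN z hz
    have := hN z hz
    rw [← hsum N z]
    simpa [Φ] using this
  have hcont : Continuous Φ := by
    rw [continuous_iff_continuousAt]
    rintro ⟨t, p⟩
    obtain ⟨C, hC, hCp⟩ := exists_compact_mem_nhds p
    have h1 := (hunif (|t| + 1) C hC).continuousOn
      (Frequently.of_forall fun n => (continuous_picIter hf ha n).continuousOn)
    refine h1.continuousAt (prod_mem_nhds (Icc_mem_nhds ?_ ?_) hCp)
    · linarith [neg_abs_le t]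
    · linarith [le_abs_self t]
  have hint : ∀ t p, Φ (t, p) = a p + ∫ s in (0 : ℝ)..t, f (s, p, Φ (s, p)) := by
    intro t p
    have hu := hunif |t| {p} isCompact_singleton
    have h1 : Tendsto (fun N => picIter f a (N + 1) (t, p)) atTop (𝓝 (Φ (t, p))) :=
      (hu.tendsto_at (x := (t, p)) ⟨abs_le.1 le_rfl, rfl⟩).comp (tendsto_add_atTop_nat 1)
    refine tendsto_nhds_unique h1 ?_
    simp only [picIter]
    refine tendsto_const_nhds.add ?_
    obtain ⟨K, hK, hKL⟩ := hL |t| {p} isCompact_singleton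
    have hΦc : Continuous fun s : ℝ => f (s, p, Φ (s, p)) := by fun_prop
    have hNc : ∀ N, Continuous fun s : ℝ => f (s, p, picIter f a N (s, p)) := by
      intro N
      have := continuous_picIter hf ha N
      fun_prop
    rw [tendsto_iff_norm_sub_tendsto_zero]
    rw [Metric.tendsto_atTop]
    intro ε hε
    rw [Metric.tendstoUniformlyOn_iff] at hu
    have hpos : 0 < K * |t| + 1 := by positivity
    obtain ⟨N0, hN0⟩ := eventually_atTop.1 (hu (ε / (K * |t| + 1)) (by positivity))
    refine ⟨N0, fun N hN => ?_⟩
    rw [dist_zero_right, norm_norm, ← intervalIntegral.integral_sub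
      ((hNc N).intervalIntegrable _ _) (hΦc.intervalIntegrable _ _)]
    have hb : ∀ s ∈ Ι 0 t, ‖f (s, p, picIter f a N (s, p)) - f (s, p, Φ (s, p))‖
        ≤ K * (ε / (K * |t| + 1)) := by
      intro s hs
      have hst : |s| ≤ |t| := by
        have h3 := Set.abs_sub_left_of_mem_uIcc (uIoc_subset_uIcc hs)
        simpa using h3
      refine (hKL s hst p rfl _ _).trans ?_
      gcongr
      have := (hN0 N hN (s, p) ⟨abs_le.1 hst, rfl⟩).le
      rwa [dist_comm, dist_eq_norm] at this
    have := intervalIntegral.norm_integral_le_of_norm_le_const hb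
    refine this.trans_lt ?_
    rw [sub_zero]
    calc K * (ε / (K * |t| + 1)) * |t| = ε * ((K * |t|) / (K * |t| + 1)) := by ring
      _ < ε * 1 := by
          gcongr
          rw [div_lt_one hpos]; linarith
      _ = ε := mul_one _
  refine ⟨Φ, hcont, fun p => by simp [hint 0 p], fun t p => ?_⟩
  have hΦc : Continuous fun s : ℝ => f (s, p, Φ (s, p)) := by fun_prop
  have h := (hΦc.integral_hasStrictDerivAt 0 t).hasDerivAt.const_add (a p)
  exact h.congr_of_eventuallyEq (Eventually.of_forall fun s => hint s p)

end ODE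


section Flow
open Set Filter Topology Interval

theorem linear_ode_unique {E : Type*} [NormedAddCommGroup E] [NormedSpace ℝ E]
    {N : ℝ → E →L[ℝ] E} (hN : Continuous N) {v w : ℝ → E}
    (hv : ∀ t, HasDerivAt v (N t (v t)) t) (hw : ∀ t, HasDerivAt w (N t (w t)) t)
    (h0 : v 0 = w 0) (t : ℝ) : v t = w t := by
  obtain ⟨K, hK⟩ := (isCompact_Icc (a := -(|t| + 1)) (b := |t| + 1)).exists_bound_of_continuousOn
    hN.continuousOn
  have hvc : Continuous v := continuous_iff_continuousAt.2 fun t => (hv t).continuousAt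
  have hwc : Continuous w := continuous_iff_continuousAt.2 fun t => (hw t).continuousAt
  have := ODE_solution_unique_of_mem_Icc (v := fun t x => N t x) (s := fun _ => univ)
    (K := K.toNNReal) (a := -(|t| + 1)) (b := |t| + 1) (t₀ := 0) (f := v) (g := w)
    (fun s hs => by
      refine ((N s).lipschitz.weaken ?_).lipschitzOnWith
      rw [← NNReal.coe_le_coe]
      have := hK s (Ioo_subset_Icc_self hs)
      exact this.trans (Real.le_coe_toNNReal K))
    (by constructor <;> linarith [abs_nonneg t]) hvc.continuousOn (fun s _ => hv s)
    (fun _ _ => trivial) hwc.continuousOn (fun s _ => hw s) (fun _ _ => trivial) h0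
  exact this ⟨by linarith [neg_abs_le t], by linarith [le_abs_self t]⟩

theorem hadamard_sub {E : Type*} [NormedAddCommGroup E] [NormedSpace ℝ E] [CompleteSpace E]
    {X : E → E} (hX : ContDiff ℝ 1 X) (a b : E) :
    X b - X a = (∫ s in (0 : ℝ)..1, fderiv ℝ X (a + s • (b - a))) (b - a) := by
  have hc : Continuous fun s : ℝ => fderiv ℝ X (a + s • (b - a)) :=
    (hX.continuous_fderiv one_ne_zero).comp (by fun_prop)
  rw [ContinuousLinearMap.intervalIntegral_apply (hc.intervalIntegrable _ _)]
  have hd : ∀ s : ℝ, HasDerivAt (fun s : ℝ => X (a + s • (b - a)))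
      (fderiv ℝ X (a + s • (b - a)) (b - a)) s := by
    intro s
    have h1 : HasDerivAt (fun s : ℝ => a + s • (b - a)) (b - a) s := by
      simpa using ((hasDerivAt_id s).smul_const (b - a)).const_add a
    exact ((hX.differentiable one_ne_zero _).hasFDerivAt).comp_hasDerivAt s h1
  rw [intervalIntegral.integral_eq_sub_of_hasDerivAt (fun s _ => hd s)]
  · simp
  · exact (hc.clm_apply continuous_const).intervalIntegrable _ _

theorem flow_hadamard {E : Type*} [NormedAddCommGroup E] [NormedSpace ℝ E]
    [FiniteDimensional ℝ E] {X : E → E} (hX : ContDiff ℝ 1 X) {Φ : ℝ × E → E}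
    (hΦ : Continuous Φ) (h0 : ∀ x, Φ (0, x) = x)
    (hd : ∀ t x, HasDerivAt (fun s => Φ (s, x)) (X (Φ (t, x))) t) :
    ∃ R : ℝ × (E × E) → E →L[ℝ] E, Continuous R ∧
      (∀ z, R (0, z) = ContinuousLinearMap.id ℝ E) ∧
      (∀ t x, HasDerivAt (fun s => R (s, (x, x)))
        ((fderiv ℝ X (Φ (t, x))).comp (R (t, (x, x)))) t) ∧
      (∀ t x y, Φ (t, y) = Φ (t, x) + R (t, (x, y)) (y - x)) := by
  have : CompleteSpace E := FiniteDimensional.complete ℝ E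
  let N : ℝ × (E × E) → E →L[ℝ] E := fun z => ∫ s in (0 : ℝ)..1,
    fderiv ℝ X (Φ (z.1, z.2.1) + s • (Φ (z.1, z.2.2) - Φ (z.1, z.2.1)))
  have hDc := hX.continuous_fderiv one_ne_zero
  have hN : Continuous N := by
    refine intervalIntegral.continuous_parametric_intervalIntegral_of_continuous'
      (f := fun (z : ℝ × (E × E)) (s : ℝ) =>
        fderiv ℝ X (Φ (z.1, z.2.1) + s • (Φ (z.1, z.2.2) - Φ (z.1, z.2.1)))) ?_ _ _
    exact hDc.comp (by fun_prop)
  obtain ⟨R, hRc, hR0, hRd⟩ := exists_param_solution (P := E × E) (E := E →L[ℝ] E)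
    (f := fun z => (N (z.1, z.2.1)).comp z.2.2) (a := fun _ => ContinuousLinearMap.id ℝ E)
    (by fun_prop) continuous_const (by
      intro T C hC
      obtain ⟨K, hK⟩ := (isCompact_Icc.prod hC).exists_bound_of_continuousOn
        (s := Icc (-T) T ×ˢ C) hN.continuousOn
      refine ⟨|K|, abs_nonneg _, fun t ht p hp x y => ?_⟩
      simp only
      rw [← ContinuousLinearMap.comp_sub]
      refine (ContinuousLinearMap.opNorm_comp_le _ _).trans ?_
      gcongr
      exact (hK (t, p) ⟨abs_le.1 ht, hp⟩).trans (le_abs_self _))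
  refine ⟨R, hRc, hR0, fun t x => ?_, fun t x y => ?_⟩
  · have := hRd t (x, x)
    simpa [N] using this
  · have hv : ∀ s, HasDerivAt (fun s => Φ (s, y) - Φ (s, x))
        (N (s, (x, y)) (Φ (s, y) - Φ (s, x))) s := by
      intro s
      have := (hd s y).sub (hd s x)
      rw [hadamard_sub hX] at this
      exact this
    have hw : ∀ s, HasDerivAt (fun s => R (s, (x, y)) (y - x))
        (N (s, (x, y)) (R (s, (x, y)) (y - x))) s := by
      intro s
      have := (hRd s (x, y)).clm_apply (hasDerivAt_const s (y - x))
      simpa using this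
    have := linear_ode_unique (N := fun s => N (s, (x, y))) (by fun_prop) hv hw
      (by simp [h0, hR0]) t
    rw [← this]; abel

theorem hasFDerivAt_clm_sub {G E F : Type*} [NormedAddCommGroup G] [NormedSpace ℝ G]
    [NormedAddCommGroup E] [NormedSpace ℝ E] [NormedAddCommGroup F] [NormedSpace ℝ F]
    {c : G → E →L[ℝ] F} {z₀ : G} (hc : ContinuousAt c z₀) (L : G →L[ℝ] E) :
    HasFDerivAt (fun z => c z (L z - L z₀)) ((c z₀).comp L) z₀ := by
  rw [hasFDerivAt_iff_isLittleO]
  have h1 : (fun z => c z - c z₀) =o[𝓝 z₀] fun _ => (1 : ℝ) := by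
    rw [Asymptotics.isLittleO_one_iff]
    exact tendsto_sub_nhds_zero_iff.2 hc
  have h2 : (fun z => ‖c z - c z₀‖ * ‖z - z₀‖) =o[𝓝 z₀] fun z => z - z₀ := by
    have := h1.norm_left.mul_isBigO (Asymptotics.isBigO_refl (fun z => ‖z - z₀‖) (𝓝 z₀))
    simpa using this
  refine Asymptotics.IsBigO.trans_isLittleO (Asymptotics.IsBigO.of_bound ‖L‖
    (Eventually.of_forall fun z => ?_)) h2
  have e : c z (L z - L z₀) - c z₀ (L z₀ - L z₀) - ((c z₀).comp L) (z - z₀)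
      = (c z - c z₀) (L (z - z₀)) := by
    simp
  rw [e]
  calc _ ≤ ‖c z - c z₀‖ * (‖L‖ * ‖z - z₀‖) :=
        ((c z - c z₀).le_opNorm _).trans (by gcongr; exact L.le_opNorm _)
    _ = ‖L‖ * ‖‖c z - c z₀‖ * ‖z - z₀‖‖ := by
        rw [Real.norm_of_nonneg (by positivity)]; ring

universe u

theorem flow_contDiff_nat (k : ℕ) : ∀ (E : Type u) [NormedAddCommGroup E] [NormedSpace ℝ E]
    [FiniteDimensional ℝ E] (X : E → E) (_ : ContDiff ℝ k X) (Φ : ℝ × E → E)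
    (_ : Continuous Φ) (_ : ∀ x, Φ (0, x) = x)
    (_ : ∀ t x, HasDerivAt (fun s => Φ (s, x)) (X (Φ (t, x))) t), ContDiff ℝ k Φ := by
  induction k with
  | zero => intro E _ _ _ X _ Φ hΦ _ _; simpa using (contDiff_zero (𝕜 := ℝ)).2 hΦ
  | succ k ih =>
    intro E _ _ _ X hX Φ hΦ h0 hd
    have hX1 : ContDiff ℝ 1 X := hX.of_le (by norm_cast; omega)
    obtain ⟨R, hRc, hR0, hRd, hR⟩ := flow_hadamard hX1 hΦ h0 hd
    have hXk : ContDiff ℝ k X := hX.of_le (by norm_cast; omega)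
    have hDXk : ContDiff ℝ k (fderiv ℝ X) := hX.fderiv_right (by norm_cast)
    have hlift : ContDiff ℝ k (fun z : ℝ × (E × (E →L[ℝ] E)) =>
        ((Φ (z.1, z.2.1), (R (z.1, (z.2.1, z.2.1))).comp z.2.2) : E × (E →L[ℝ] E))) := by
      refine ih (E × (E →L[ℝ] E)) (fun w => (X w.1, (fderiv ℝ X w.1).comp w.2)) ?_ _ ?_ ?_ ?_
      · refine (hXk.comp contDiff_fst).prodMk ?_
        exact (hDXk.comp contDiff_fst).clm_comp contDiff_snd
      · fun_prop
      · intro x; simp [h0, hR0]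
      · intro t x
        refine (hd t x.1).prodMk ?_
        have := (hRd t x.1).clm_comp (hasDerivAt_const t x.2)
        simpa [ContinuousLinearMap.comp_assoc] using this
    have hΦk : ContDiff ℝ k Φ := by
      have h1 : ContDiff ℝ k fun z : ℝ × E => (z.1, (z.2, (0 : E →L[ℝ] E))) := by fun_prop
      exact contDiff_fst.comp (hlift.comp h1)
    have hAk : ContDiff ℝ k fun z : ℝ × E => R (z.1, (z.2, z.2)) := by
      have h1 : ContDiff ℝ k fun z : ℝ × E => (z.1, (z.2, ContinuousLinearMap.id ℝ E)) := by
        fun_prop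
      simpa [Function.comp_def] using contDiff_snd.comp (hlift.comp h1)
    push_cast
    rw [contDiff_succ_iff_hasFDerivAt]
    refine ⟨fun z => (ContinuousLinearMap.fst ℝ ℝ E).smulRight (X (Φ z))
      + (R (z.1, (z.2, z.2))).comp (ContinuousLinearMap.snd ℝ ℝ E), ?_, ?_⟩
    · refine ContDiff.add ?_ (hAk.clm_comp contDiff_const)
      exact contDiff_const.smulRight (hXk.comp hΦk)
    · rintro ⟨t, x⟩
      have e : Φ = fun z : ℝ × E => Φ (z.1, x) + R (z.1, (x, z.2))
          (ContinuousLinearMap.snd ℝ ℝ E z - ContinuousLinearMap.snd ℝ ℝ E (t, x)) := by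
        funext z
        exact hR z.1 x z.2
      rw [e]
      refine HasFDerivAt.add ?_ ?_
      · have h1 := (hd t x).hasFDerivAt.comp (t, x)
          (hasFDerivAt_fst (𝕜 := ℝ) (E := ℝ) (F := E) (p := (t, x)))
        convert! h1 using 1
        ext <;> simp
      · have h2 : ContinuousAt (fun z : ℝ × E => R (z.1, (x, z.2))) (t, x) := by
          apply Continuous.continuousAt; fun_prop
        exact hasFDerivAt_clm_sub h2 (ContinuousLinearMap.snd ℝ ℝ E)

theorem exists_smooth_flow (E : Type u) [NormedAddCommGroup E] [NormedSpace ℝ E]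
    [FiniteDimensional ℝ E] (X : E → E) (hX : ContDiff ℝ (⊤ : ℕ∞) X) (K : NNReal)
    (hL : LipschitzWith K X) :
    ∃ Φ : ℝ × E → E, ContDiff ℝ (⊤ : ℕ∞) Φ ∧ (∀ x, Φ (0, x) = x) ∧
      ∀ t x, HasDerivAt (fun s => Φ (s, x)) (X (Φ (t, x))) t := by
  have : CompleteSpace E := FiniteDimensional.complete ℝ E
  obtain ⟨Φ, hc, h0, hd⟩ := exists_param_solution (P := E) (E := E)
    (f := fun z => X z.2.2) (a := id) (hX.continuous.comp (by fun_prop)) continuous_id (by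
      intro T C _
      refine ⟨K, K.2, fun t _ p _ x y => ?_⟩
      simpa [dist_eq_norm] using hL.dist_le_mul x y)
  refine ⟨Φ, ?_, h0, hd⟩
  rw [contDiff_infty]
  intro n
  exact flow_contDiff_nat n E X (contDiff_infty.1 hX n) Φ hc h0 hd

end Flow


section Torus
open Set Filter Topology

theorem one_dim_fun {ε : ℝ} (hε : 0 < ε) (hε2 : ε < 1 / 2) :
    ∃ g : ℝ → ℝ, ContDiff ℝ (⊤ : ℕ∞) g ∧ (∀ (x : ℝ) (m : ℤ), g (x + m) = g x) ∧
      ∃ δ : ℝ, 0 < δ ∧ ∀ x : ℝ, (∃ m : ℤ, |x - m| < ε) ∨ δ ≤ |deriv g x| := by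
  have hpi := Real.pi_pos
  set c := Real.cos (2 * Real.pi * ε) with hc
  have hc1 : c < 1 := by
    rw [hc, ← Real.cos_zero]
    exact Real.cos_lt_cos_of_nonneg_of_le_pi le_rfl (by nlinarith) (by positivity)
  have hcm : -1 ≤ c := Real.neg_one_le_cos _
  set r := 1 + (1 - c) / 2 with hr
  have hr1 : 1 < r := by rw [hr]; linarith
  have hrc : 0 < 1 - r * c := by rw [hr]; nlinarith
  have hden : ∀ x, 0 < r - Real.cos (2 * Real.pi * x) := fun x => by
    linarith [Real.cos_le_one (2 * Real.pi * x)]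
  refine ⟨fun x => Real.sin (2 * Real.pi * x) / (r - Real.cos (2 * Real.pi * x)), ?_, ?_,
    2 * Real.pi * (1 - r * c) / (r + 1) ^ 2, by positivity, ?_⟩
  · refine ContDiff.div ?_ ?_ fun x => (hden x).ne'
    · exact Real.contDiff_sin.comp (by fun_prop)
    · exact contDiff_const.sub (Real.contDiff_cos.comp (by fun_prop))
  · intro x m
    have e : 2 * Real.pi * (x + m) = 2 * Real.pi * x + m * (2 * Real.pi) := by ring
    simp only [e, Real.sin_add_int_mul_two_pi, Real.cos_add_int_mul_two_pi]
  · intro x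
    rcases lt_or_ge c (Real.cos (2 * Real.pi * x)) with h | h
    · left
      refine ⟨round x, ?_⟩
      by_contra! hcon
      have h2 := abs_sub_round x
      have e : Real.cos (2 * Real.pi * x) = Real.cos (2 * Real.pi * |x - round x|) := by
        have e1 : 2 * Real.pi * |x - round x| = |2 * Real.pi * (x - round x)| := by
          rw [abs_mul, abs_of_pos (by positivity : 0 < 2 * Real.pi)]
        rw [e1, Real.cos_abs,
          show 2 * Real.pi * (x - round x) = 2 * Real.pi * x - round x * (2 * Real.pi) by ring,
          Real.cos_sub_int_mul_two_pi]
      have := Real.cos_le_cos_of_nonneg_of_le_pi (x := 2 * Real.pi * ε)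
        (y := 2 * Real.pi * |x - round x|) (by positivity) (by nlinarith) (by gcongr)
      rw [← e] at this
      linarith
    · right
      have hl : HasDerivAt (fun x : ℝ => 2 * Real.pi * x) (2 * Real.pi) x := by
        simpa using (hasDerivAt_id x).const_mul (2 * Real.pi)
      have hd := (hl.sin).div ((hl.cos).const_sub r) (hden x).ne'
      have e := hd.deriv
      change deriv (fun x => Real.sin (2 * Real.pi * x) / (r - Real.cos (2 * Real.pi * x))) x = _
        at e
      rw [e]
      set C := Real.cos (2 * Real.pi * x)
      set S := Real.sin (2 * Real.pi * x)
      have hCS : S ^ 2 + C ^ 2 = 1 := Real.sin_sq_add_cos_sq _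
      have e2 : (C * (2 * Real.pi) * (r - C) - S * -(-S * (2 * Real.pi)))
          = - (2 * Real.pi * (1 - r * C)) := by
        linear_combination (-2 * Real.pi) * hCS
      rw [e2, abs_div, abs_neg]
      have hC : -1 ≤ C := Real.neg_one_le_cos _
      have h1 : 1 - r * c ≤ 1 - r * C := by nlinarith
      have h0 := hden x
      rw [abs_of_pos (by have : 0 < 1 - r * C := by linarith
                         positivity), abs_of_pos (pow_pos h0 2)]
      gcongr
      · exact mul_nonneg (by positivity) (by linarith)
      · linarith

theorem torus_fun {n : ℕ} (q₀ : EuclideanSpace ℝ (Fin n)) {ε : ℝ} (hε : 0 < ε)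
    (hε2 : ε < 1 / 2) :
    ∃ f : EuclideanSpace ℝ (Fin n) → ℝ, ContDiff ℝ (⊤ : ℕ∞) f ∧
      (∀ (m : Fin n → ℤ) (q : EuclideanSpace ℝ (Fin n)),
        f (q + (EuclideanSpace.equiv (Fin n) ℝ).symm (fun i => (m i : ℝ))) = f q) ∧
      ∃ δ : ℝ, 0 < δ ∧ ∀ q, (∃ m : Fin n → ℤ, ∀ i, |q i - q₀ i - m i| < ε) ∨
        δ ≤ ‖fderiv ℝ f q‖ := by
  obtain ⟨g, hg, hgp, δ, hδ, hgd⟩ := one_dim_fun hε hε2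
  refine ⟨fun q => ∑ i, g (q i - q₀ i), ?_, ?_, δ, hδ, ?_⟩
  · refine ContDiff.sum fun i _ => hg.comp ?_
    fun_prop
  · intro m q
    refine Finset.sum_congr rfl fun i _ => ?_
    have : (q + (EuclideanSpace.equiv (Fin n) ℝ).symm (fun i => (m i : ℝ))) i - q₀ i
        = q i - q₀ i + m i := by
      simp; ring
    rw [this, hgp]
  · intro q
    by_cases h : ∀ i, ∃ m : ℤ, |q i - q₀ i - m| < ε
    · left
      choose m hm using h
      exact ⟨m, hm⟩
    · right
      push Not at h
      obtain ⟨i, hi⟩ := h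
      have h1 : δ ≤ |deriv g (q i - q₀ i)| := by
        rcases hgd (q i - q₀ i) with ⟨m, hm⟩ | h
        · exact absurd hm (not_lt.2 (hi m))
        · exact h
      have hd : HasFDerivAt (fun q : EuclideanSpace ℝ (Fin n) => ∑ i, g (q i - q₀ i))
          (∑ i, (deriv g (q i - q₀ i)) • (EuclideanSpace.proj i :
            EuclideanSpace ℝ (Fin n) →L[ℝ] ℝ)) q := by
        refine HasFDerivAt.fun_sum fun j _ => ?_
        have h2 : HasFDerivAt (fun q : EuclideanSpace ℝ (Fin n) => q j - q₀ j)
            (EuclideanSpace.proj j : EuclideanSpace ℝ (Fin n) →L[ℝ] ℝ) q :=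
          ((EuclideanSpace.proj j : EuclideanSpace ℝ (Fin n) →L[ℝ] ℝ).hasFDerivAt).sub_const _
        exact ((hg.differentiable (by simp)) (q j - q₀ j)).hasDerivAt.comp_hasFDerivAt q h2
      rw [hd.fderiv]
      have h3 := (∑ i, (deriv g (q i - q₀ i)) • (EuclideanSpace.proj i :
            EuclideanSpace ℝ (Fin n) →L[ℝ] ℝ)).le_opNorm (EuclideanSpace.single i 1)
      have h4 : (∑ i, (deriv g (q i - q₀ i)) • (EuclideanSpace.proj i :
            EuclideanSpace ℝ (Fin n) →L[ℝ] ℝ)) (EuclideanSpace.single i 1)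
            = deriv g (q i - q₀ i) := by
        simp
      rw [h4] at h3
      simp only [PiLp.norm_single, norm_one, mul_one, Real.norm_eq_abs] at h3
      exact h1.trans h3

theorem periodic_bound {n : ℕ} {W : Type*} [NormedAddCommGroup W]
    {u : EuclideanSpace ℝ (Fin n) × EuclideanSpace ℝ (Fin n) → W} (hu : Continuous u)
    (hper : ∀ (m : Fin n → ℤ) (q p : EuclideanSpace ℝ (Fin n)),
      u (q + (EuclideanSpace.equiv (Fin n) ℝ).symm (fun i => (m i : ℝ)), p) = u (q, p))
    {C : Set (EuclideanSpace ℝ (Fin n))} (hC : IsCompact C) :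
    ∃ M : ℝ, ∀ q, ∀ p ∈ C, ‖u (q, p)‖ ≤ M := by
  let Q : Set (EuclideanSpace ℝ (Fin n)) :=
    Set.image (EuclideanSpace.equiv (Fin n) ℝ).symm (Set.pi univ fun _ => Icc (0 : ℝ) 1)
  have hQ : IsCompact Q := (isCompact_univ_pi fun _ => isCompact_Icc).image
    (EuclideanSpace.equiv (Fin n) ℝ).symm.continuous
  obtain ⟨M, hM⟩ := (hQ.prod hC).exists_bound_of_continuousOn hu.continuousOn
  refine ⟨M, fun q p hp => ?_⟩
  have e : q = (EuclideanSpace.equiv (Fin n) ℝ).symm (fun i => Int.fract (q i))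
      + (EuclideanSpace.equiv (Fin n) ℝ).symm (fun i => ((⌊q i⌋ : ℤ) : ℝ)) := by
    ext i; simp
  rw [e, hper]
  exact hM _ ⟨⟨_, fun i _ => ⟨Int.fract_nonneg _, (Int.fract_lt_one _).le⟩, rfl⟩, hp⟩

theorem periodic_lipschitz {n : ℕ} {W : Type*} [NormedAddCommGroup W] [NormedSpace ℝ W]
    {X : EuclideanSpace ℝ (Fin n) × EuclideanSpace ℝ (Fin n) → W} (hX : ContDiff ℝ (⊤ : ℕ∞) X)
    (hper : ∀ (m : Fin n → ℤ) (q p : EuclideanSpace ℝ (Fin n)),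
      X (q + (EuclideanSpace.equiv (Fin n) ℝ).symm (fun i => (m i : ℝ)), p) = X (q, p))
    {R : ℝ} (hR : ∀ q p, R < ‖p‖ → X (q, p) = 0) :
    ∃ K : NNReal, LipschitzWith K X := by
  obtain ⟨M, hM⟩ := periodic_bound (u := fderiv ℝ X) (hX.continuous_fderiv (by simp)) (by
    intro m q p
    have e : X = fun z => X (z + ((EuclideanSpace.equiv (Fin n) ℝ).symm
        (fun i => (m i : ℝ)), (0 : EuclideanSpace ℝ (Fin n)))) := by
      funext ⟨q, p⟩
      simp only [Prod.mk_add_mk, add_zero]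
      exact (hper m q p).symm
    conv_rhs => rw [e]
    rw [fderiv_comp_add_right]
    simp) (isCompact_closedBall (0 : EuclideanSpace ℝ (Fin n)) R)
  refine ⟨M.toNNReal, lipschitzWith_of_nnnorm_fderiv_le (hX.differentiable (by simp)) ?_⟩
  rintro ⟨q, p⟩
  rw [← NNReal.coe_le_coe]
  by_cases hp : ‖p‖ ≤ R
  · exact (hM q p (by simpa using hp)).trans (Real.le_coe_toNNReal M)
  · have h0 : X =ᶠ[𝓝 (q, p)] fun _ => 0 := by
      have : ∀ᶠ z : EuclideanSpace ℝ (Fin n) × EuclideanSpace ℝ (Fin n) in 𝓝 (q, p),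
          R < ‖z.2‖ :=
        (continuous_snd.norm.continuousAt).eventually (lt_mem_nhds (not_le.1 hp))
      filter_upwards [this] with z hz using hR _ _ hz
    rw [h0.fderiv_eq]
    simp

theorem nhds_cube {n : ℕ} {q₀ : EuclideanSpace ℝ (Fin n)} {S : Set (EuclideanSpace ℝ (Fin n))}
    (hS : S ∈ 𝓝 q₀) : ∃ ε : ℝ, 0 < ε ∧ ε < 1 / 2 ∧ ∀ q, (∀ i, |q i - q₀ i| < ε) → q ∈ S := by
  have h1 : Set.preimage (EuclideanSpace.equiv (Fin n) ℝ).symm S ∈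
      𝓝 (EuclideanSpace.equiv (Fin n) ℝ q₀) := by
    apply (EuclideanSpace.equiv (Fin n) ℝ).symm.continuous.continuousAt
    simpa using hS
  obtain ⟨ε, hε, hb⟩ := Metric.mem_nhds_iff.1 h1
  refine ⟨min ε (1 / 4), by positivity, (min_le_right _ _).trans_lt (by norm_num), fun q hq => ?_⟩
  have : EuclideanSpace.equiv (Fin n) ℝ q ∈
      Metric.ball (EuclideanSpace.equiv (Fin n) ℝ q₀) ε := by
    rw [Metric.mem_ball, dist_pi_lt_iff hε]
    intro i
    exact (hq i).trans_le (min_le_left _ _)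
  simpa using hb this

theorem gradient_const_mul' {V : Type*} [NormedAddCommGroup V] [InnerProductSpace ℝ V]
    [CompleteSpace V] (c : ℝ) {f : V → ℝ} (hf : Differentiable ℝ f) (x : V) :
    gradient (fun y => c * f y) x = c • gradient f x := by
  unfold gradient
  rw [fderiv_const_mul (hf x)]
  simp

theorem contDiff_gradient {V : Type*} [NormedAddCommGroup V] [InnerProductSpace ℝ V]
    [CompleteSpace V] {f : V → ℝ} (hf : ContDiff ℝ (⊤ : ℕ∞) f) :
    ContDiff ℝ (⊤ : ℕ∞) (gradient f) := by
  have h1 : ContDiff ℝ (⊤ : ℕ∞) (fderiv ℝ f) := hf.fderiv_right (by simp)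
  exact ((InnerProductSpace.toDual ℝ V).symm.toContinuousLinearEquiv.toContinuousLinearMap.contDiff
    (n := (⊤ : ℕ∞))).comp h1

end Torus

open Set Filter Topology

/-- Theorem 1.4 of the paper (displaceability of sublevel sets below `e₀(H)`)
instantiated on the flat torus `𝕋ⁿ`, in lifted coordinates on
`ℝⁿ = EuclideanSpace ℝ (Fin n)`.

If `H` is a Tonelli Hamiltonian on `𝕋ⁿ`, `B` a magnetic field on `𝕋ⁿ`, and
`k < e₀(H) = sup_q inf_p H(q,p)`, then there are `R > 0`, a smooth
time-dependent Hamiltonian `F` which is `ℤⁿ`-periodic in `q` and vanishes for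
`‖p‖ ≥ R`, and its twisted Hamiltonian flow `Φ`, which is `ℤⁿ`-equivariant and
whose time-one map displaces the sublevel set `{H ≤ k}`. -/
theorem displaceability_of_sublevels_on_torus
    (n : ℕ)
    (H : EuclideanSpace ℝ (Fin n) × EuclideanSpace ℝ (Fin n) → ℝ)
    (B : EuclideanSpace ℝ (Fin n) →
      EuclideanSpace ℝ (Fin n) →L[ℝ] EuclideanSpace ℝ (Fin n))
    (hHsmooth : ContDiff ℝ (⊤ : ℕ∞) H)
    (hHper : ∀ (m : Fin n → ℤ) (q p : EuclideanSpace ℝ (Fin n)),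
      H (q + (EuclideanSpace.equiv (Fin n) ℝ).symm (fun i => (m i : ℝ)), p) = H (q, p))
    (hHconv : ∀ (q p v : EuclideanSpace ℝ (Fin n)), v ≠ 0 →
      0 < iteratedFDeriv ℝ 2 (fun p' => H (q, p')) p ![v, v])
    (hHsuper : ∀ A : ℝ, 0 < A → ∃ C : ℝ, ∀ q p, A * ‖p‖ - C ≤ H (q, p))
    (hBsmooth : ContDiff ℝ (⊤ : ℕ∞) B)
    (hBper : ∀ (m : Fin n → ℤ) (q : EuclideanSpace ℝ (Fin n)),
      B (q + (EuclideanSpace.equiv (Fin n) ℝ).symm (fun i => (m i : ℝ))) = B q)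
    (hBskew : ∀ q u v : EuclideanSpace ℝ (Fin n), ⟪B q u, v⟫ = -⟪B q v, u⟫)
    (hBclosed : ∀ q u v w : EuclideanSpace ℝ (Fin n),
      ⟪(fderiv ℝ B q u) v, w⟫ + ⟪(fderiv ℝ B q v) w, u⟫ + ⟪(fderiv ℝ B q w) u, v⟫ = 0)
    (k : ℝ)
    (hk : k < ⨆ q : EuclideanSpace ℝ (Fin n), ⨅ p : EuclideanSpace ℝ (Fin n), H (q, p)) :
    ∃ R : ℝ, 0 < R ∧
      ∃ F : ℝ × (EuclideanSpace ℝ (Fin n) × EuclideanSpace ℝ (Fin n)) → ℝ,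
        ContDiff ℝ (⊤ : ℕ∞) F ∧
        (∀ (t : ℝ) (m : Fin n → ℤ) (q p : EuclideanSpace ℝ (Fin n)),
          F (t, (q + (EuclideanSpace.equiv (Fin n) ℝ).symm (fun i => (m i : ℝ)), p))
            = F (t, (q, p))) ∧
        (∀ (t : ℝ) (q p : EuclideanSpace ℝ (Fin n)), R ≤ ‖p‖ → F (t, (q, p)) = 0) ∧
        ∃ Φ : ℝ × (EuclideanSpace ℝ (Fin n) × EuclideanSpace ℝ (Fin n)) →
            EuclideanSpace ℝ (Fin n) × EuclideanSpace ℝ (Fin n),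
          ContDiff ℝ (⊤ : ℕ∞) Φ ∧
          (∀ z, Φ (0, z) = z) ∧
          (∀ (t : ℝ) (z : EuclideanSpace ℝ (Fin n) × EuclideanSpace ℝ (Fin n)),
            HasDerivAt (fun s => Φ (s, z))
              (gradient (fun p' => F (t, ((Φ (t, z)).1, p'))) (Φ (t, z)).2,
               -gradient (fun q' => F (t, (q', (Φ (t, z)).2))) (Φ (t, z)).1
                 - B (Φ (t, z)).1
                     (gradient (fun p' => F (t, ((Φ (t, z)).1, p'))) (Φ (t, z)).2))
              t) ∧
          (∀ (t : ℝ) (m : Fin n → ℤ) (q p : EuclideanSpace ℝ (Fin n)),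
            Φ (t, (q + (EuclideanSpace.equiv (Fin n) ℝ).symm (fun i => (m i : ℝ)), p))
              = ((Φ (t, (q, p))).1 + (EuclideanSpace.equiv (Fin n) ℝ).symm
                  (fun i => (m i : ℝ)), (Φ (t, (q, p))).2)) ∧
          (∀ q p : EuclideanSpace ℝ (Fin n), H (q, p) ≤ k → k < H (Φ (1, (q, p)))) := by
  obtain ⟨q₀, hq₀⟩ := exists_lt_of_lt_ciSup hk
  obtain ⟨C₁, hC₁⟩ := hHsuper 1 one_pos
  simp only [one_mul] at hC₁
  have hq₀' : ∀ p, k < H (q₀, p) := fun p => hq₀.trans_le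
    (ciInf_le ⟨-C₁, by rintro _ ⟨p, rfl⟩; linarith [hC₁ q₀ p, norm_nonneg p]⟩ p)
  -- near `q₀` the whole fibre lies above level `k`
  have hnear : {q | ∀ p ∈ Metric.closedBall (0 : EuclideanSpace ℝ (Fin n)) (k + C₁),
      k < H (q, p)} ∈ 𝓝 q₀ := by
    refine (isCompact_closedBall _ _).eventually_forall_of_forall_eventually fun p _ => ?_
    exact hHsmooth.continuous.continuousAt.eventually (lt_mem_nhds (hq₀' p))
  obtain ⟨ε, hε, hε2, hcube⟩ := nhds_cube hnear
  have hfib : ∀ q, (∀ i, |q i - q₀ i| < ε) → ∀ p, k < H (q, p) := by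
    intro q hq p
    by_cases hp : ‖p‖ ≤ k + C₁
    · exact hcube q hq p (by simpa using hp)
    · linarith [hC₁ q p, not_le.1 hp]
  obtain ⟨f, hf, hfper, δ, hδ, hfd⟩ := torus_fun q₀ hε hε2
  set c : ℝ := (2 * |k + C₁| + 1) / δ with hc
  have hcpos : 0 < c := by positivity
  set g : EuclideanSpace ℝ (Fin n) → ℝ := fun q => c * f q with hgdef
  have hg : ContDiff ℝ (⊤ : ℕ∞) g := contDiff_const.mul hf
  have hgper : ∀ (m : Fin n → ℤ) (q : EuclideanSpace ℝ (Fin n)),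
      g (q + (EuclideanSpace.equiv (Fin n) ℝ).symm (fun i => (m i : ℝ))) = g q := by
    intro m q; simp only [hgdef, hfper]
  have hgg : ContDiff ℝ (⊤ : ℕ∞) (gradient g) := contDiff_gradient hg
  have hggper : ∀ (m : Fin n → ℤ) (q : EuclideanSpace ℝ (Fin n)),
      gradient g (q + (EuclideanSpace.equiv (Fin n) ℝ).symm (fun i => (m i : ℝ)))
        = gradient g q := by
    intro m q
    have e : g = fun z => g (z + (EuclideanSpace.equiv (Fin n) ℝ).symm
        (fun i => (m i : ℝ))) := by
      funext q; exact (hgper m q).symm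
    unfold gradient
    conv_rhs => rw [e]
    rw [fderiv_comp_add_right]
  have hglow : ∀ q, (∃ m : Fin n → ℤ, ∀ i, |q i - q₀ i - m i| < ε) ∨
      2 * |k + C₁| + 1 ≤ ‖gradient g q‖ := by
    intro q
    refine (hfd q).imp id fun h => ?_
    rw [hgdef, gradient_const_mul' c (hf.differentiable (by simp)), norm_smul,
      Real.norm_of_nonneg hcpos.le]
    have e : ‖gradient f q‖ = ‖fderiv ℝ f q‖ := by simp [gradient]
    rw [e]
    calc 2 * |k + C₁| + 1 = c * δ := by rw [hc]; field_simp
      _ ≤ _ := by gcongr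
  obtain ⟨M, hM⟩ := periodic_bound
    (u := fun z : EuclideanSpace ℝ (Fin n) × EuclideanSpace ℝ (Fin n) => gradient g z.1)
    (hgg.continuous.comp continuous_fst) (fun m q p => hggper m q)
    (isCompact_singleton (x := (0 : EuclideanSpace ℝ (Fin n))))
  have hM' : ∀ q, ‖gradient g q‖ ≤ |M| := fun q => (hM q 0 rfl).trans (le_abs_self M)
  -- the cutoff in the fibre direction
  set R₁ : ℝ := |k + C₁| + |M| + 1 with hR₁
  have hR₁pos : 0 < R₁ := by positivity
  let b : ContDiffBump (0 : EuclideanSpace ℝ (Fin n)) := ⟨R₁, R₁ + 1, hR₁pos, by linarith⟩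
  set χ : EuclideanSpace ℝ (Fin n) → ℝ := fun p => b p with hχdef
  have hχ : ContDiff ℝ (⊤ : ℕ∞) χ := b.contDiff
  have hχ1 : ∀ p, ‖p‖ ≤ R₁ → χ p = 1 := fun p hp =>
    b.one_of_mem_closedBall (by simpa using hp)
  have hχ0 : ∀ p, R₁ + 1 ≤ ‖p‖ → χ p = 0 := fun p hp =>
    b.zero_of_le_dist (by simpa using hp)
  have hχg : ContDiff ℝ (⊤ : ℕ∞) (gradient χ) := contDiff_gradient hχ
  have hχg1 : ∀ p, ‖p‖ < R₁ → gradient χ p = 0 := by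
    intro p hp
    have : χ =ᶠ[𝓝 p] fun _ => 1 := by
      filter_upwards [continuous_norm.continuousAt.eventually (gt_mem_nhds hp)] with p' hp'
      exact hχ1 p' hp'.le
    rw [gradient, this.fderiv_eq]
    simp
  have hχg0 : ∀ p, R₁ + 1 < ‖p‖ → gradient χ p = 0 := by
    intro p hp
    have : χ =ᶠ[𝓝 p] fun _ => 0 := by
      filter_upwards [continuous_norm.continuousAt.eventually (lt_mem_nhds hp)] with p' hp'
      exact hχ0 p' hp'.le
    rw [gradient, this.fderiv_eq]
    simp
  -- the Hamiltonian vector field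
  let X : EuclideanSpace ℝ (Fin n) × EuclideanSpace ℝ (Fin n) →
      EuclideanSpace ℝ (Fin n) × EuclideanSpace ℝ (Fin n) := fun z =>
    (g z.1 • gradient χ z.2, -(χ z.2 • gradient g z.1) - B z.1 (g z.1 • gradient χ z.2))
  have hX : ContDiff ℝ (⊤ : ℕ∞) X := by
    have h1 : ContDiff ℝ (⊤ : ℕ∞)
        fun z : EuclideanSpace ℝ (Fin n) × EuclideanSpace ℝ (Fin n) =>
          g z.1 • gradient χ z.2 :=
      (hg.comp contDiff_fst).smul (hχg.comp contDiff_snd)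
    exact h1.prodMk ((((hχ.comp contDiff_snd).smul (hgg.comp contDiff_fst)).neg).sub
      ((hBsmooth.comp contDiff_fst).clm_apply h1))
  have hXper : ∀ (m : Fin n → ℤ) (q p : EuclideanSpace ℝ (Fin n)),
      X (q + (EuclideanSpace.equiv (Fin n) ℝ).symm (fun i => (m i : ℝ)), p) = X (q, p) := by
    intro m q p
    simp only [X, hgper, hggper, hBper]
  have hX0 : ∀ q p, R₁ + 1 < ‖p‖ → X (q, p) = 0 := by
    intro q p hp
    simp [X, hχg0 p hp, hχ0 p hp.le]
  obtain ⟨K, hK⟩ := periodic_lipschitz hX hXper hX0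
  obtain ⟨Φ, hΦ, hΦ0, hΦd⟩ := exists_smooth_flow _ X hX K hK
  refine ⟨R₁ + 1, by linarith, fun z => g z.2.1 * χ z.2.2, ?_, ?_, ?_, Φ, hΦ, hΦ0, ?_, ?_, ?_⟩
  · exact (hg.comp (contDiff_fst.comp contDiff_snd)).mul
      (hχ.comp (contDiff_snd.comp contDiff_snd))
  · intro t m q p
    simp only [hgper]
  · intro t q p hp
    simp [hχ0 p hp]
  · intro t z
    have e1 : ∀ q p, gradient (fun p' => g q * χ p') p = g q • gradient χ p := fun q p =>
      gradient_const_mul' _ (hχ.differentiable (by simp)) p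
    have e2 : ∀ q p, gradient (fun q' => g q' * χ p) q = χ p • gradient g q := fun q p => by
      rw [← gradient_const_mul' _ (hg.differentiable (by simp)) q]
      congr 1
      funext q'
      ring
    simp only [e1, e2]
    exact hΦd t z
  · intro t m q p
    set v := (EuclideanSpace.equiv (Fin n) ℝ).symm (fun i => (m i : ℝ)) with hv
    have h := ODE_solution_unique_univ (v := fun _ => X) (s := fun _ => univ) (K := K) (t₀ := 0)
      (f := fun s => Φ (s, (q + v, p)))
      (g := fun s => Φ (s, (q, p)) + (v, (0 : EuclideanSpace ℝ (Fin n))))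
      (fun _ => hK.lipschitzOnWith) (fun s => ⟨hΦd s _, trivial⟩)
      (fun s => ⟨by
        have h1 := (hΦd s (q, p)).add_const (v, (0 : EuclideanSpace ℝ (Fin n)))
        have h2 : X (Φ (s, (q, p)) + (v, (0 : EuclideanSpace ℝ (Fin n))))
            = X (Φ (s, (q, p))) := by
          have := hXper m (Φ (s, (q, p))).1 (Φ (s, (q, p))).2
          rw [← this]
          congr 1
          ext <;> simp [hv]
        rw [h2]
        exact h1, trivial⟩) (by simp [hΦ0])
    have h3 := congrFun h t
    rw [h3]
    ext <;> simp
  · intro q p hqp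
    have hp : ‖p‖ ≤ |k + C₁| := by linarith [hC₁ q p, le_abs_self (k + C₁)]
    have hlow : 2 * |k + C₁| + 1 ≤ ‖gradient g q‖ := by
      refine (hglow q).resolve_left ?_
      rintro ⟨m, hm⟩
      set v := (EuclideanSpace.equiv (Fin n) ℝ).symm (fun i => (m i : ℝ)) with hv
      have h1 := hfib (q - v) (fun i => by
        have e : (q - v) i - q₀ i = q i - q₀ i - m i := by simp [hv]; ring
        rw [e]; exact hm i) p
      have h2 := hHper m (q - v) p
      rw [← hv, sub_add_cancel] at h2
      linarith
    have hpath : ∀ t ∈ Ico (0 : ℝ) 1, ‖p - t • gradient g q‖ < R₁ := by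
      intro t ht
      calc _ ≤ ‖p‖ + ‖t • gradient g q‖ := norm_sub_le _ _
        _ ≤ |k + C₁| + 1 * |M| := by
            rw [norm_smul, Real.norm_of_nonneg ht.1]
            gcongr
            · exact ht.2.le
            · exact hM' q
        _ < R₁ := by rw [hR₁]; linarith
    have hγ : ∀ t, HasDerivAt (fun t : ℝ => (q, p - t • gradient g q))
        (0, -gradient g q) t := by
      intro t
      refine (hasDerivAt_const t q).prodMk ?_
      simpa using ((hasDerivAt_id t).smul_const (gradient g q)).const_sub p
    have hΦc : Continuous fun s : ℝ => Φ (s, (q, p)) := hΦ.continuous.comp (by fun_prop)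
    have h := ODE_solution_unique (v := fun _ => X) (K := K) (a := 0) (b := 1)
      (f := fun s => Φ (s, (q, p))) (g := fun t : ℝ => (q, p - t • gradient g q))
      (fun _ => hK) hΦc.continuousOn (fun t _ => (hΦd t _).hasDerivWithinAt)
      (fun t _ => (hγ t).continuousAt.continuousWithinAt)
      (fun t ht => by
        have e : X (q, p - t • gradient g q) = (0, -gradient g q) := by
          simp only [X, hχg1 _ (hpath t ht), hχ1 _ (hpath t ht).le]
          simp
        rw [e]
        exact (hγ t).hasDerivWithinAt) (by simp [hΦ0])
    have h1 := h (right_mem_Icc.2 zero_le_one)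
    simp only [one_smul] at h1
    rw [h1]
    have h2 := hC₁ q (p - gradient g q)
    have h3 := norm_sub_norm_le (gradient g q) p
    rw [norm_sub_rev] at h3
    linarith [le_abs_self (k + C₁)]
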